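/- Let ω = (−1 + i√3)/2 and let Q be an n×n nontrivial cube root Seidel matrix in standard form satisfying Q² = (n−1)·I + μ·Q for a real number μ. Then μ is an integer, 4(n−1) + μ² is a perfect square (there exists m ∈ ℤ with m² = 4(n−1) + μ²), and 4(n−1) + μ² ≡ 0 (mod 9). -/

import Mathlib

/-- `ω = (−1 + i√3)/2`, a primitive cube root of unity. -/
noncomputable def ω3 : ℂ := (-1 + Complex.I * Real.sqrt 3) / 2

/-- A cube root Seidel matrix: self-adjoint, zero diagonal, off-diagonal
entries among the cube roots of unity. -/
def IsCubeRootSeidel {n : ℕ} (Q : Matrix (Fin n) (Fin n) ℂ) : Prop :=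
  Q.IsHermitian ∧ (∀ i, Q i i = 0) ∧
    ∀ i j, i ≠ j → Q i j = 1 ∨ Q i j = ω3 ∨ Q i j = ω3 ^ 2

/-- Standard form: every off-diagonal entry in the first row and first column
equals 1. -/
def IsStandardForm {n : ℕ} (Q : Matrix (Fin n) (Fin n) ℂ) : Prop :=
  ∀ i j : Fin n, i ≠ j → (i.val = 0 ∨ j.val = 0) → Q i j = 1

/-- Nontrivial: some off-diagonal entry is not equal to 1. -/
def IsNontrivial {n : ℕ} (Q : Matrix (Fin n) (Fin n) ℂ) : Prop :=
  ∃ i j : Fin n, i ≠ j ∧ Q i j ≠ 1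

theorem ω3_sq : ω3 ^ 2 = -1 - ω3 := by
  have h : ((Real.sqrt 3 : ℝ) : ℂ) ^ 2 = 3 := by
    rw [← Complex.ofReal_pow, Real.sq_sqrt (by norm_num)]
    norm_num
  unfold ω3
  linear_combination (Complex.I ^ 2 / 4) * h + (3 / 4) * Complex.I_sq

theorem ω3_re : ω3.re = -1 / 2 := by
  simp [ω3]

theorem ω3_im : ω3.im = Real.sqrt 3 / 2 := by
  simp [ω3]

/-- `1` and `ω3` are linearly independent over `ℝ`. -/
theorem eq_of_add_mul_ω3_eq {a b c d : ℝ}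
    (h : (a : ℂ) + b * ω3 = c + d * ω3) : a = c ∧ b = d := by
  have him := congrArg Complex.im h
  have hre := congrArg Complex.re h
  simp [ω3_re, ω3_im] at him hre
  subst him
  exact ⟨by linarith, rfl⟩

/-- A finite sum of multiples by `c` of Eisenstein integers is a multiple by `c` of an
Eisenstein integer. -/
theorem exists_sum_eq_mul_eisenstein {ι : Type*} (s : Finset ι) (f : ι → ℂ) (c : ℂ)
    (h : ∀ k ∈ s, ∃ p q : ℤ, f k = c * (p + q * ω3)) :
    ∃ p q : ℤ, ∑ k ∈ s, f k = c * (p + q * ω3) := by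
  refine Finset.sum_induction f (fun z => ∃ p q : ℤ, z = c * (p + q * ω3)) ?_ ⟨0, 0, by simp⟩ h
  rintro _ _ ⟨p, q, rfl⟩ ⟨p', q', rfl⟩
  exact ⟨p + p', q + q', by push_cast; ring⟩

theorem Matrix.exists_nat_trace_eq_of_isIdempotentElem {n : ℕ} {P : Matrix (Fin n) (Fin n) ℂ}
    (hP : IsIdempotentElem P) : ∃ k : ℕ, P.trace = k := by
  have h : IsIdempotentElem (Matrix.toLin' P) := by
    rw [IsIdempotentElem, Module.End.mul_eq_comp, ← Matrix.toLin'_mul, hP.eq]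
  refine ⟨Module.finrank ℂ (LinearMap.range (Matrix.toLin' P)), ?_⟩
  rw [← Matrix.trace_toLin'_eq]
  exact (LinearMap.IsIdempotentElem.isProj_range _ h).trace

/-- The multiplicity equation for a traceless matrix with two eigenvalues. -/
theorem Matrix.exists_nat_mul_sub_eq_of_trace_eq_zero {n : ℕ} {Q : Matrix (Fin n) (Fin n) ℂ}
    {a b s : ℂ} (htr : Q.trace = 0) (hQ : Q ^ 2 = a • (1 : Matrix (Fin n) (Fin n) ℂ) + b • Q)
    (hs : s ≠ 0) (hsq : s ^ 2 = 4 * a + b ^ 2) :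
    ∃ k : ℕ, (n : ℂ) * (s - b) = 2 * s * k := by
  have hP : IsIdempotentElem
      (((s - b) / (2 * s)) • (1 : Matrix (Fin n) (Fin n) ℂ) + (1 / s) • Q) := by
    have hx : ((s - b) / (2 * s)) ^ 2 + (1 / s) ^ 2 * a = (s - b) / (2 * s) := by
      field_simp
      linear_combination -hsq
    have hy : 2 * ((s - b) / (2 * s)) * (1 / s) + (1 / s) ^ 2 * b = 1 / s := by
      field_simp
      ring
    generalize (s - b) / (2 * s) = x at hx hy ⊢
    generalize 1 / s = y at hx hy ⊢
    rw [IsIdempotentElem]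
    simp only [add_mul, mul_add, smul_mul_assoc, mul_smul_comm, one_mul, mul_one, ← pow_two Q, hQ]
    nth_rewrite 4 [← hx]
    nth_rewrite 5 [← hy]
    module
  obtain ⟨k, hk⟩ := Matrix.exists_nat_trace_eq_of_isIdempotentElem hP
  refine ⟨k, ?_⟩
  rw [Matrix.trace_add, Matrix.trace_smul, Matrix.trace_smul, htr, Matrix.trace_one] at hk
  rw [← hk]
  simp
  field_simp

/-- A product of two elements of `{0, 1 - ω3, 1 - ω3 ^ 2}` is divisible by `3`. -/
theorem exists_one_sub_mul_one_sub_eq {x y : ℂ} (hx : x = 1 ∨ x = ω3 ∨ x = ω3 ^ 2)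
    (hy : y = 1 ∨ y = ω3 ∨ y = ω3 ^ 2) :
    ∃ p q : ℤ, (1 - x) * (1 - y) = 3 * (p + q * ω3) := by
  have h := ω3_sq
  rcases hx with rfl | hx
  · exact ⟨0, 0, by simp⟩
  rcases hy with rfl | hy
  · exact ⟨0, 0, by simp⟩
  rcases hx with rfl | rfl <;> rcases hy with rfl | rfl
  · exact ⟨0, -1, by push_cast; linear_combination h⟩
  · exact ⟨1, 0, by push_cast; linear_combination (ω3 - 2) * h⟩
  · exact ⟨1, 0, by push_cast; linear_combination (ω3 - 2) * h⟩
  · exact ⟨1, 1, by push_cast; linear_combination (ω3 ^ 2 - ω3 - 2) * h⟩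

section

variable {n : ℕ} {Q : Matrix (Fin n) (Fin n) ℂ} {μ : ℝ}

theorem IsCubeRootSeidel.row_sum (hQ : IsCubeRootSeidel Q) (hsf : IsStandardForm Q)
    (heq : Q ^ 2 = ((n : ℂ) - 1) • (1 : Matrix (Fin n) (Fin n) ℂ) + (μ : ℂ) • Q)
    {i z : Fin n} (hz : z.val = 0) (hi : i ≠ z) : ∑ k, Q i k = μ + 1 := by
  have h := congrFun₂ heq i z
  have hcol : ∀ k, Q k z = 1 - if k = z then 1 else 0 := by
    intro k
    split_ifs with hk
    · simp [hk, hQ.2.1]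
    · simp [hsf k z hk (Or.inr hz)]
  simp only [pow_two, Matrix.mul_apply, Matrix.add_apply, Matrix.smul_apply, hcol, hi,
    Matrix.one_apply, mul_sub, Finset.sum_sub_distrib] at h
  simp at h
  have hiz := hcol i
  simp only [hi, if_false, sub_zero] at hiz
  rw [hiz] at h
  linear_combination h

theorem IsCubeRootSeidel.col_sum (hQ : IsCubeRootSeidel Q) (hsf : IsStandardForm Q)
    (heq : Q ^ 2 = ((n : ℂ) - 1) • (1 : Matrix (Fin n) (Fin n) ℂ) + (μ : ℂ) • Q)
    {j z : Fin n} (hz : z.val = 0) (hj : j ≠ z) : ∑ k, Q k j = μ + 1 := by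
  have h := congrArg star (hQ.row_sum hsf heq hz hj)
  simp only [star_sum, hQ.1.apply] at h
  simpa using h

theorem IsCubeRootSeidel.exists_int (hQ : IsCubeRootSeidel Q) (hsf : IsStandardForm Q)
    (heq : Q ^ 2 = ((n : ℂ) - 1) • (1 : Matrix (Fin n) (Fin n) ℂ) + (μ : ℂ) • Q)
    {i z : Fin n} (hz : z.val = 0) (hi : i ≠ z) : ∃ m : ℤ, μ = m := by
  obtain ⟨p, q, h⟩ := exists_sum_eq_mul_eisenstein Finset.univ (fun k => Q i k) 1 (by
    intro k _
    by_cases hk : i = k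
    · exact ⟨0, 0, by simp [← hk, hQ.2.1]⟩
    rcases hQ.2.2 i k hk with h | h | h
    · exact ⟨1, 0, by simp [h]⟩
    · exact ⟨0, 1, by simp [h]⟩
    · exact ⟨-1, -1, by simp [h, ω3_sq]; ring⟩)
  rw [hQ.row_sum hsf heq hz hi] at h
  have := (eq_of_add_mul_ω3_eq (a := μ + 1) (b := 0) (c := p) (d := q)
    (by push_cast; linear_combination h)).1
  exact ⟨p - 1, by push_cast; linarith⟩

theorem IsCubeRootSeidel.exists_mod_three (hQ : IsCubeRootSeidel Q) (hsf : IsStandardForm Q)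
    (heq : Q ^ 2 = ((n : ℂ) - 1) • (1 : Matrix (Fin n) (Fin n) ℂ) + (μ : ℂ) • Q)
    {i j z : Fin n} (hz : z.val = 0) (hi : i ≠ z) (hj : j ≠ z) (hij : i ≠ j) :
    ∃ p q : ℤ, (n : ℂ) - 2 * μ - 4 + (μ + 2) * Q i j = 3 * (p + q * ω3) := by
  have hδ : ∀ k l, Q k l + (if k = l then 1 else 0) = 1 ∨
      Q k l + (if k = l then 1 else 0) = ω3 ∨ Q k l + (if k = l then 1 else 0) = ω3 ^ 2 := by
    intro k l
    split_ifs with hkl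
    · simp [hkl, hQ.2.1]
    · simpa using hQ.2.2 k l hkl
  obtain ⟨p, q, h⟩ := exists_sum_eq_mul_eisenstein Finset.univ
    (fun k => (1 - (Q i k + if i = k then 1 else 0)) * (1 - (Q k j + if k = j then 1 else 0))) 3
    (fun k _ => exists_one_sub_mul_one_sub_eq (hδ i k) (hδ k j))
  refine ⟨p, q, ?_⟩
  rw [← h]
  have hsq := congrFun₂ heq i j
  simp only [pow_two, Matrix.mul_apply, Matrix.add_apply, Matrix.smul_apply, Matrix.one_apply,
    hij, if_false, smul_eq_mul, mul_zero, zero_add] at hsq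
  have hr := hQ.row_sum hsf heq hz hi
  have hc := hQ.col_sum hsf heq hz hj
  simp only [mul_sub, sub_mul, mul_add, add_mul, Finset.sum_sub_distrib, Finset.sum_add_distrib,
    mul_one, one_mul, hr, hc, hsq]
  simp [hij]
  ring

end

theorem cubeRootSeidel_perfect_square_condition
    (n : ℕ) (Q : Matrix (Fin n) (Fin n) ℂ) (μ : ℝ)
    (hQ : IsCubeRootSeidel Q) (hsf : IsStandardForm Q) (hnt : IsNontrivial Q)
    (heq : Q ^ 2 = ((n : ℂ) - 1) • (1 : Matrix (Fin n) (Fin n) ℂ) + (μ : ℂ) • Q) :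
    ∃ m : ℤ, μ = (m : ℝ) ∧ (∃ s : ℤ, s ^ 2 = 4 * ((n : ℤ) - 1) + m ^ 2) ∧
      (4 * ((n : ℤ) - 1) + m ^ 2) % 9 = 0 := by
  obtain ⟨i, j, hij, hne⟩ := hnt
  obtain ⟨z, hz⟩ : ∃ z : Fin n, z.val = 0 := ⟨⟨0, i.pos⟩, rfl⟩
  have hi : i ≠ z := fun h => hne (hsf i j hij (Or.inl (h ▸ hz)))
  have hj : j ≠ z := fun h => hne (hsf i j hij (Or.inr (h ▸ hz)))
  obtain ⟨m, rfl⟩ := hQ.exists_int hsf heq hz hi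
  have hmod : (3 : ℤ) ∣ m + 2 ∧ (3 : ℤ) ∣ n := by
    obtain ⟨p, q, h⟩ := hQ.exists_mod_three hsf heq hz hi hj hij
    rcases (hQ.2.2 i j hij).resolve_left hne with hω | hω
    · rw [hω] at h
      obtain ⟨h1, h2⟩ := eq_of_add_mul_ω3_eq (a := n - 2 * m - 4) (b := m + 2) (c := 3 * p)
        (d := 3 * q) (by push_cast at h ⊢; linear_combination h)
      norm_cast at h1 h2
      omega
    · rw [hω, ω3_sq] at h
      obtain ⟨h1, h2⟩ := eq_of_add_mul_ω3_eq (a := n - 2 * m - 4 - (m + 2)) (b := -(m + 2))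
        (c := 3 * p) (d := 3 * q) (by push_cast at h ⊢; linear_combination h)
      norm_cast at h1 h2
      omega
  have hn : (0 : ℤ) < n := by exact_mod_cast i.pos
  have hm : m ≠ 0 := by rintro rfl; omega
  have hD : 4 * ((n : ℤ) - 1) + m ^ 2 ≠ 0 := by
    have := sq_pos_of_ne_zero hm
    omega
  obtain ⟨s, hs⟩ := IsAlgClosed.exists_pow_nat_eq (4 * ((n : ℂ) - 1) + (m : ℂ) ^ 2) two_pos
  have hs0 : s ≠ 0 := by
    rintro rfl
    apply hD
    have : 4 * ((n : ℂ) - 1) + (m : ℂ) ^ 2 = 0 := by simpa using hs.symm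
    exact_mod_cast this
  obtain ⟨k, hk⟩ := Matrix.exists_nat_mul_sub_eq_of_trace_eq_zero
    (by simp [Matrix.trace, hQ.2.1]) heq hs0 (by push_cast; exact hs)
  have hint : (4 * ((n : ℤ) - 1) + m ^ 2) * (n - 2 * k) ^ 2 = (n * m) ^ 2 := by
    have hlin : s * (n - 2 * k) = n * m := by
      push_cast at hk
      linear_combination hk
    have : (4 * ((n : ℂ) - 1) + (m : ℂ) ^ 2) * (n - 2 * k) ^ 2 = (n * m) ^ 2 := by
      rw [← hs, ← hlin]
      ring
    exact_mod_cast this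
  have hpos : ((n : ℤ) - 2 * k) ≠ 0 := by
    intro h
    rw [h] at hint
    have : (n : ℤ) * m ≠ 0 := mul_ne_zero hn.ne' hm
    exact pow_ne_zero 2 this (by simpa using hint.symm)
  obtain ⟨t, ht⟩ : (n : ℤ) - 2 * k ∣ n * m :=
    (Int.pow_dvd_pow_iff two_ne_zero).1 (Dvd.intro_left _ hint)
  have hsq : t ^ 2 = 4 * ((n : ℤ) - 1) + m ^ 2 := by
    apply mul_right_cancel₀ (pow_ne_zero 2 hpos)
    rw [hint, ht]
    ring
  refine ⟨m, rfl, ⟨t, hsq⟩, ?_⟩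
  obtain ⟨⟨a, ha⟩, b, hb⟩ := hmod
  have h3 : (3 : ℤ) ∣ t ^ 2 := by
    obtain rfl : m = 3 * a - 2 := by omega
    rw [hsq, hb]
    exact ⟨4 * b + 3 * a ^ 2 - 4 * a, by ring⟩
  obtain ⟨c, rfl⟩ := Int.prime_three.dvd_of_dvd_pow h3
  rw [← hsq]
  exact Int.emod_eq_zero_of_dvd ⟨c ^ 2, by ring⟩
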